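/- Suppose for each k = 1,…,K, matrices H_k ∈ ℂ^{N_k×M}, P_k ∈ ℂ^{M×D_k}, weights α_k > 0, and noise powers σ_k² > 0 satisfy, for all k: Σ_k α_k σ_k² Tr((Σ_{j=1}^K H_k P_j P_jᴴ H_kᴴ + σ_k² I)⁻¹) = Σ_k α_k σ_k² Tr((Σ_{j≠k} H_k P_j P_jᴴ H_kᴴ + σ_k² I)⁻¹). Then H_k P_k = 0 for all k. -/

import Mathlib

open Matrix

open scoped ComplexOrder in
lemma aux_diff {n d : ℕ} (S : Matrix (Fin n) (Fin n) ℂ) (hS : S.PosDef)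
    (G : Matrix (Fin n) (Fin d) ℂ) :
    (S⁻¹ - (S + G * Gᴴ)⁻¹).PosSemidef := by
  have hQ : (G * Gᴴ).PosSemidef := posSemidef_self_mul_conjTranspose G
  set Q := G * Gᴴ with hQdef
  have hT : (S + Q).PosDef := hS.add_posSemidef hQ
  have hSd : IsUnit S.det := (Matrix.isUnit_iff_isUnit_det _).1 hS.isUnit
  have hTd : IsUnit (S + Q).det := (Matrix.isUnit_iff_isUnit_det _).1 hT.isUnit
  have hmid : (Q + Q * S⁻¹ * Qᴴ).PosSemidef :=
    hQ.add (hS.inv.posSemidef.mul_mul_conjTranspose_same Q)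
  have h1 := hmid.mul_mul_conjTranspose_same (S + Q)⁻¹
  have e : S⁻¹ - (S + Q)⁻¹ = (S + Q)⁻¹ * (Q + Q * S⁻¹ * Qᴴ) * ((S + Q)⁻¹)ᴴ := by
    rw [hT.inv.isHermitian.eq, hQ.isHermitian.eq]
    have e2 : Q + Q * S⁻¹ * Q = (S + Q) * S⁻¹ * (S + Q) - (S + Q) := by
      have a := Matrix.mul_nonsing_inv S hSd
      have b := Matrix.nonsing_inv_mul S hSd
      simp only [Matrix.add_mul, Matrix.mul_add, a, Matrix.mul_assoc Q S⁻¹ S, b, Matrix.one_mul,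
        Matrix.mul_one]
      abel
    have c := Matrix.mul_nonsing_inv _ hTd
    have c' := Matrix.nonsing_inv_mul _ hTd
    rw [e2, Matrix.mul_sub, Matrix.sub_mul, c', Matrix.one_mul]
    congr 1
    rw [← Matrix.mul_assoc, ← Matrix.mul_assoc, c', Matrix.one_mul, Matrix.mul_assoc, c,
      Matrix.mul_one]
  rw [e]
  exact h1

open scoped ComplexOrder in
lemma aux_zero {n d : ℕ} (S : Matrix (Fin n) (Fin n) ℂ) (hS : S.PosDef)
    (G : Matrix (Fin n) (Fin d) ℂ) (h : ((S + G * Gᴴ)⁻¹).trace = (S⁻¹).trace) :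
    G = 0 := by
  have hT : (S + G * Gᴴ).PosDef := hS.add_posSemidef (posSemidef_self_mul_conjTranspose G)
  have hSd : IsUnit S.det := (Matrix.isUnit_iff_isUnit_det _).1 hS.isUnit
  have hTd : IsUnit (S + G * Gᴴ).det := (Matrix.isUnit_iff_isUnit_det _).1 hT.isUnit
  have h0 := (aux_diff S hS G).trace_eq_zero_iff.1 (by rw [Matrix.trace_sub, h, sub_self])
  have h1 : S⁻¹ = (S + G * Gᴴ)⁻¹ := sub_eq_zero.1 h0
  have h2 : S = S + G * Gᴴ := by
    have h4 := congrArg (fun A => A⁻¹) h1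
    simpa only [Matrix.nonsing_inv_nonsing_inv _ hSd, Matrix.nonsing_inv_nonsing_inv _ hTd] using h4
  have h3 : G * Gᴴ = 0 := by simpa using h2.symm
  exact Matrix.self_mul_conjTranspose_eq_zero.1 h3

/-- If the weighted traces of the inverses with and without the desired-signal terms
agree, then every effective channel `H_k P_k` vanishes. -/
theorem trace_equality_implies_zero_effective_channel (K M : ℕ) (Nk Dk : Fin K → ℕ)
    (H : ∀ k : Fin K, Matrix (Fin (Nk k)) (Fin M) ℂ)
    (P : ∀ k : Fin K, Matrix (Fin M) (Fin (Dk k)) ℂ)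
    (α σ : Fin K → ℝ) (hα : ∀ k, 0 < α k) (hσ : ∀ k, 0 < (σ k) ^ 2)
    (h : ∑ k, ((α k : ℂ) * ((σ k : ℂ) ^ 2) *
          (((∑ j, H k * P j * (P j)ᴴ * (H k)ᴴ) +
            ((σ k : ℂ) ^ 2) • (1 : Matrix (Fin (Nk k)) (Fin (Nk k)) ℂ))⁻¹).trace) =
        ∑ k, ((α k : ℂ) * ((σ k : ℂ) ^ 2) *
          (((∑ j ∈ Finset.univ.erase k, H k * P j * (P j)ᴴ * (H k)ᴴ) +
            ((σ k : ℂ) ^ 2) • (1 : Matrix (Fin (Nk k)) (Fin (Nk k)) ℂ))⁻¹).trace)) :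
    ∀ k, H k * P k = 0 := by
  open scoped ComplexOrder in
  have hpd : ∀ k, ((∑ j ∈ Finset.univ.erase k, H k * P j * (P j)ᴴ * (H k)ᴴ) +
      ((σ k : ℂ) ^ 2) • (1 : Matrix (Fin (Nk k)) (Fin (Nk k)) ℂ)).PosDef := by
    intro k
    refine Matrix.PosDef.posSemidef_add ?_ ?_
    · refine Matrix.posSemidef_sum _ fun j _ => ?_
      have := posSemidef_self_mul_conjTranspose (H k * P j)
      rwa [Matrix.conjTranspose_mul, ← Matrix.mul_assoc] at this
    · refine Matrix.PosDef.one.smul ?_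
      exact_mod_cast hσ k
  have hsplit : ∀ k, (∑ j, H k * P j * (P j)ᴴ * (H k)ᴴ) +
      ((σ k : ℂ) ^ 2) • (1 : Matrix (Fin (Nk k)) (Fin (Nk k)) ℂ) =
      ((∑ j ∈ Finset.univ.erase k, H k * P j * (P j)ᴴ * (H k)ᴴ) +
      ((σ k : ℂ) ^ 2) • (1 : Matrix (Fin (Nk k)) (Fin (Nk k)) ℂ)) +
        (H k * P k) * (H k * P k)ᴴ := by
    intro k
    rw [← Finset.sum_erase_add _ _ (Finset.mem_univ k), Matrix.conjTranspose_mul,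
      ← Matrix.mul_assoc]
    abel
  simp only [hsplit] at h
  open scoped ComplexOrder in
  have hc : ∀ k, (0 : ℂ) < (α k : ℂ) * (σ k : ℂ) ^ 2 := by
    intro k
    exact_mod_cast mul_pos (hα k) (hσ k)
  intro k
  refine aux_zero _ (hpd k) _ ?_
  open scoped ComplexOrder in
  have key := (Finset.sum_eq_sum_iff_of_le (fun i _ => mul_le_mul_of_nonneg_left (by
    have := (aux_diff _ (hpd i) (H i * P i)).trace_nonneg
    rwa [Matrix.trace_sub, sub_nonneg] at this) (hc i).le)).1 h k (Finset.mem_univ k)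
  exact mul_left_cancel₀ (hc k).ne' key
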